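/- arXiv:2407.18694 — 2 statements merged into one kernel-verified Lean document; each statement's English description precedes it below -/
import Mathlib

section
/- Let (W_e, Δ_e) be a finite Coxeter system with root system Φ_e, and let σ_I be a diagram automorphism of Δ_e. Let K_1, K_2 ⊆ Δ_e be σ_I-stable subsets, and let c_1, c_2 be σ_I-Coxeter elements of the parabolic subgroups W_{K_1}, W_{K_2} respectively. If w ∈ W_e satisfies c_1 σ_I(w) = w c_2, then there exists x ∈ {}^{K_1}W_e{}^{K_2} (the set of minimal-length double coset representatives) with x(K_2) = K_1 and w ∈ x W_{K_2}. -/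
open Classical in
def SameOrbit {B : Type*} (σ : Equiv.Perm B) (i j : B) : Prop :=
  ∃ n : ℤ, (σ ^ n) i = j

section Dihedral
variable {V : Type*} [AddCommGroup V] [Module ℝ V]

theorem dih_pow_x (x y : V) (f g : V →ₗ[ℝ] ℝ) (θ : ℝ) (hf : f x = 2) (hg : g y = 2)
    (hfy : f y = -2 * Real.cos θ) (hgx : g x = -2 * Real.cos θ) (n : ℕ) :
    Real.sin θ • ((Module.preReflection x f * Module.preReflection y g) ^ n) x =
      Real.sin ((2 * n + 1) * θ) • x + Real.sin (2 * n * θ) • y := by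
  induction n with
  | zero => simp
  | succ n ih =>
    rw [pow_succ', Module.End.mul_apply, ← map_smul, ih]
    simp only [map_add, map_smul, Module.End.mul_apply, Module.preReflection_apply, map_sub,
      hf, hg, hfy, hgx, smul_eq_mul]
    have e1 : Real.sin ((2 * n + 1) * θ) = Real.sin (2 * n * θ) * Real.cos θ
        + Real.cos (2 * n * θ) * Real.sin θ := by
      rw [← Real.sin_add]; ring_nf
    have e2 : Real.sin (2 * ((n + 1 : ℕ) : ℝ) * θ) = Real.sin (2 * n * θ) * Real.cos (2 * θ)
        + Real.cos (2 * n * θ) * Real.sin (2 * θ) := by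
      rw [← Real.sin_add]; push_cast; ring_nf
    have e3 : Real.sin ((2 * ((n + 1 : ℕ) : ℝ) + 1) * θ) = Real.sin (2 * n * θ) * Real.cos (2 * θ + θ)
        + Real.cos (2 * n * θ) * Real.sin (2 * θ + θ) := by
      rw [← Real.sin_add]; push_cast; ring_nf
    rw [e1, e2, e3, Real.cos_add, Real.sin_add, Real.cos_two_mul, Real.sin_two_mul]
    have hs : Real.sin θ ^ 2 = 1 - Real.cos θ ^ 2 := by
      have := Real.sin_sq_add_cos_sq θ; linarith
    generalize Real.sin (2 * n * θ) = S
    generalize Real.cos (2 * n * θ) = C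
    generalize Real.cos θ = c at *
    generalize Real.sin θ = s at *
    match_scalars
    · linear_combination (2 * S * c) * hs
    · ring

theorem dih_pow_y (x y : V) (f g : V →ₗ[ℝ] ℝ) (θ : ℝ) (hf : f x = 2) (hg : g y = 2)
    (hfy : f y = -2 * Real.cos θ) (hgx : g x = -2 * Real.cos θ) (n : ℕ) :
    Real.sin θ • ((Module.preReflection x f * Module.preReflection y g) ^ n) y =
      - Real.sin (2 * n * θ) • x - Real.sin ((2 * n - 1) * θ) • y := by
  induction n with
  | zero => simp
  | succ n ih =>
    rw [pow_succ', Module.End.mul_apply, ← map_smul, ih]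
    simp only [map_sub, map_smul, Module.End.mul_apply, Module.preReflection_apply,
      hf, hg, hfy, hgx, smul_eq_mul]
    have e1 : Real.sin ((2 * n - 1) * θ) = Real.sin (2 * n * θ) * Real.cos θ
        - Real.cos (2 * n * θ) * Real.sin θ := by
      rw [← Real.sin_sub]; ring_nf
    have e2 : Real.sin (2 * ((n + 1 : ℕ) : ℝ) * θ) = Real.sin (2 * n * θ) * Real.cos (2 * θ)
        + Real.cos (2 * n * θ) * Real.sin (2 * θ) := by
      rw [← Real.sin_add]; push_cast; ring_nf
    have e3 : Real.sin ((2 * ((n + 1 : ℕ) : ℝ) - 1) * θ) = Real.sin (2 * n * θ) * Real.cos θ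
        + Real.cos (2 * n * θ) * Real.sin θ := by
      rw [← Real.sin_add]; push_cast; ring_nf
    rw [e1, e2, e3, Real.cos_two_mul, Real.sin_two_mul]
    generalize Real.sin (2 * n * θ) = S
    generalize Real.cos (2 * n * θ) = C
    generalize Real.cos θ = c at *
    generalize Real.sin θ = s at *
    match_scalars
    · ring
    · ring

theorem dih_rel (x y : V) (f g : V →ₗ[ℝ] ℝ) (m : ℕ) (hm : 2 ≤ m) (hf : f x = 2) (hg : g y = 2)
    (hfy : f y = -2 * Real.cos (Real.pi / m)) (hgx : g x = -2 * Real.cos (Real.pi / m)) :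
    (Module.preReflection x f * Module.preReflection y g) ^ m = 1 := by
  have hm0 : (m : ℝ) ≠ 0 := by positivity
  have hm2 : (2 : ℝ) ≤ m := by exact_mod_cast hm
  have hs : 0 < Real.sin (Real.pi / m) := by
    apply Real.sin_pos_of_pos_of_lt_pi (by positivity)
    rw [div_lt_iff₀ (by positivity)]
    nlinarith [Real.pi_pos]
  have hx := dih_pow_x x y f g _ hf hg hfy hgx m
  have hy := dih_pow_y x y f g _ hf hg hfy hgx m
  have a1 : (2 * (m : ℝ) + 1) * (Real.pi / m) = Real.pi / m + 2 * Real.pi := by field_simp; ring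
  have a2 : 2 * (m : ℝ) * (Real.pi / m) = 2 * Real.pi := by field_simp
  have a3 : (2 * (m : ℝ) - 1) * (Real.pi / m) = -(Real.pi / m) + 2 * Real.pi := by
    field_simp; ring
  rw [a1, a2, Real.sin_add_two_pi, Real.sin_two_pi] at hx
  rw [a2, a3, Real.sin_add_two_pi, Real.sin_two_pi, Real.sin_neg] at hy
  set r := Module.preReflection x f * Module.preReflection y g with hr
  have hx' : (r ^ m) x = x := by
    apply smul_right_injective V hs.ne'; simpa using hx
  have hy' : (r ^ m) y = y := by
    apply smul_right_injective V hs.ne'; simpa using hy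
  have hsq : Real.sin (Real.pi / m) ^ 2 = 1 - Real.cos (Real.pi / m) ^ 2 := by
    have := Real.sin_sq_add_cos_sq (Real.pi / m); linarith
  have hD : (1 - Real.cos (Real.pi / m) ^ 2) ≠ 0 := by rw [← hsq]; positivity
  generalize Real.cos (Real.pi / m) = c at *
  ext v
  obtain ⟨a, ha⟩ : ∃ a, a = (f v + c * g v) / (2 * (1 - c ^ 2)) := ⟨_, rfl⟩
  obtain ⟨b, hb⟩ : ∃ b, b = (g v + c * f v) / (2 * (1 - c ^ 2)) := ⟨_, rfl⟩
  obtain ⟨v0, hv0⟩ : ∃ v0, v0 = v - a • x - b • y := ⟨_, rfl⟩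
  have hf0 : f v0 = 0 := by
    rw [hv0]; simp only [map_sub, map_smul, hf, hfy, smul_eq_mul, ha, hb]; field_simp; ring
  have hg0 : g v0 = 0 := by
    rw [hv0]; simp only [map_sub, map_smul, hg, hgx, smul_eq_mul, ha, hb]; field_simp; ring
  have hr0 : r v0 = v0 := by
    simp [hr, Module.preReflection_apply, hf0, hg0]
  have hrm : ∀ n : ℕ, (r ^ n) v0 = v0 := by
    intro n
    induction n with
    | zero => simp
    | succ n ih => rw [pow_succ, Module.End.mul_apply, hr0, ih]
  have hv : v = v0 + a • x + b • y := by rw [hv0]; abel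
  rw [hv]
  simp [hx', hy', hrm]

end Dihedral

section Geom
variable {B : Type*} [Fintype B]

/-- simple root -/
noncomputable def sroot (i : B) : B → ℝ := by
  classical exact Pi.single i 1

/-- The functional `v ↦ 2 B(α_i, v)`. -/
noncomputable def scoroot (m : B → B → ℕ) (i : B) : (B → ℝ) →ₗ[ℝ] ℝ :=
  ∑ j, (-2 * Real.cos (Real.pi / m i j)) • LinearMap.proj j

theorem scoroot_apply (m : B → B → ℕ) (i : B) (v : B → ℝ) :
    scoroot m i v = ∑ j, (-2 * Real.cos (Real.pi / m i j)) * v j := by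
  simp [scoroot]

theorem scoroot_sroot (m : B → B → ℕ) (i j : B) :
    scoroot m i (sroot j) = -2 * Real.cos (Real.pi / m i j) := by
  classical
  rw [scoroot_apply]
  simp [sroot, Pi.single_apply]

/-- A matrix of admissible exponents. -/
structure GoodM (m : B → B → ℕ) : Prop where
  symm : ∀ i j, m i j = m j i
  diag : ∀ i, m i i = 1
  off : ∀ i j, i ≠ j → m i j ≠ 1

theorem GoodM.two {m : B → B → ℕ} (hm : GoodM m) (i : B) : scoroot m i (sroot i) = 2 := by
  rw [scoroot_sroot, hm.diag]; simp

noncomputable def gref (m : B → B → ℕ) (i : B) : Module.End ℝ (B → ℝ) :=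
  Module.preReflection (sroot i) (scoroot m i)

theorem gref_apply (m : B → B → ℕ) (i : B) (v : B → ℝ) :
    gref m i v = v - scoroot m i v • sroot i := by
  simp [gref, Module.preReflection_apply]

theorem gref_mul_self {m : B → B → ℕ} (hm : GoodM m) (i : B) : gref m i * gref m i = 1 := by
  ext1 v
  simp only [Module.End.mul_apply, gref_apply, map_sub, map_smul, hm.two, smul_eq_mul,
    Module.End.one_apply]
  module

theorem gref_rel {m : B → B → ℕ} (hm : GoodM m) (i j : B) :
    (gref m i * gref m j) ^ (m i j) = 1 := by
  by_cases hij : i = j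
  · subst hij; rw [gref_mul_self hm, one_pow]
  by_cases h0 : m i j = 0
  · rw [h0, pow_zero]
  have := hm.off i j hij
  refine dih_rel _ _ _ _ _ (by omega) (hm.two i) (hm.two j) (scoroot_sroot _ _ _) ?_
  rw [scoroot_sroot, hm.symm]

variable {W : Type*} [Group W] {M : CoxeterMatrix B} (cs : CoxeterSystem M W)

theorem gref_liftable {m : B → B → ℕ} (hm : GoodM m) (hd : ∀ i j, m i j ∣ M i j) :
    M.IsLiftable (gref m) := by
  intro i j
  obtain ⟨k, hk⟩ := hd i j
  rw [hk, pow_mul, gref_rel hm, one_pow]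

theorem sroot_inj {i j : B} {a b : ℝ} (ha : a ≠ 0) (h : a • sroot i = b • sroot j) : i = j := by
  classical
  by_contra hij
  have := congrFun h i
  simp [sroot, Pi.single_apply, hij] at this
  exact ha this

theorem simple_inj : Function.Injective cs.simple := by
  intro i j h
  have hm : GoodM (fun i j => M i j) :=
    ⟨fun i j => M.symmetric i j, fun i => M.diagonal i, fun i j hij => M.off_diagonal i j hij⟩
  have hl := gref_liftable (M := M) hm (fun _ _ => dvd_rfl)
  have h1 := cs.lift_apply_simple hl i
  have h2 := cs.lift_apply_simple hl j
  rw [h, h2] at h1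
  have h3 := congrArg (fun F => F (sroot i)) h1
  simp only [gref_apply, hm.two] at h3
  have h4 : (2 : ℝ) • sroot i = scoroot (fun i j => M i j) j (sroot i) • sroot j := by
    have := sub_right_injective h3
    exact this.symm
  exact sroot_inj (by norm_num) h4



/-- The order of a product of two simple reflections. -/
noncomputable def ordM (i j : B) : ℕ := orderOf (cs.simple i * cs.simple j)

theorem ordM_good : GoodM (ordM cs) := by
  refine ⟨fun i j => ?_, fun i => ?_, fun i j hij h => hij ?_⟩
  · unfold ordM
    rw [← orderOf_inv, mul_inv_rev, cs.inv_simple, cs.inv_simple]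
  · simp [ordM]
  · apply simple_inj cs
    rw [ordM, orderOf_eq_one_iff] at h
    rw [← cs.inv_simple j]
    exact eq_inv_of_mul_eq_one_left h

noncomputable def grep : W →* Module.End ℝ (B → ℝ) :=
  cs.lift ⟨gref (ordM cs), gref_liftable (ordM_good cs)
    (fun i j => orderOf_dvd_of_pow_eq_one (cs.simple_mul_simple_pow i j))⟩

/-- Functional for the group. -/
noncomputable def fn (i : B) : (B → ℝ) →ₗ[ℝ] ℝ := scoroot (ordM cs) i

theorem fn_self (i : B) : fn cs i (sroot i) = 2 := (ordM_good cs).two i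

theorem fn_sroot (i j : B) : fn cs i (sroot j) = -2 * Real.cos (Real.pi / ordM cs i j) :=
  scoroot_sroot _ _ _

theorem fn_symm (i j : B) : fn cs i (sroot j) = fn cs j (sroot i) := by
  rw [fn_sroot, fn_sroot, (ordM_good cs).symm]

theorem grep_simple (i : B) (v : B → ℝ) :
    grep cs (cs.simple i) v = v - fn cs i v • sroot i := by
  unfold grep
  rw [cs.lift_apply_simple, gref_apply]; rfl

theorem grep_mul (x y : W) (v : B → ℝ) : grep cs (x * y) v = grep cs x (grep cs y v) := by
  rw [map_mul, Module.End.mul_apply]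

theorem grep_one (v : B → ℝ) : grep cs 1 v = v := by
  rw [map_one, Module.End.one_apply]

theorem vec_eq_sum (v : B → ℝ) : v = ∑ i, v i • sroot i := by
  classical
  ext k
  simp [sroot, Finset.sum_apply, Pi.single_apply]

/-- The bilinear form (times two). -/
noncomputable def bf (u v : B → ℝ) : ℝ := ∑ i, u i * fn cs i v

theorem bf_sroot (i : B) (v : B → ℝ) : bf cs (sroot i) v = fn cs i v := by
  classical
  simp [bf, sroot, Pi.single_apply]

theorem bf_add_left (u u' v : B → ℝ) : bf cs (u + u') v = bf cs u v + bf cs u' v := by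
  simp [bf, add_mul, Finset.sum_add_distrib]
theorem bf_smul_left (a : ℝ) (u v : B → ℝ) : bf cs (a • u) v = a * bf cs u v := by
  simp [bf, mul_assoc, Finset.mul_sum]
theorem bf_sub_left (u u' v : B → ℝ) : bf cs (u - u') v = bf cs u v - bf cs u' v := by
  simp [bf, sub_mul, Finset.sum_sub_distrib]
theorem bf_sub_right (u v v' : B → ℝ) : bf cs u (v - v') = bf cs u v - bf cs u v' := by
  simp [bf, mul_sub, Finset.sum_sub_distrib]
theorem bf_smul_right (a : ℝ) (u v : B → ℝ) : bf cs u (a • v) = a * bf cs u v := by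
  simp only [bf, map_smul, smul_eq_mul, Finset.mul_sum]
  exact Finset.sum_congr rfl fun _ _ => by ring

theorem bf_right_sroot (u : B → ℝ) (i : B) : bf cs u (sroot i) = fn cs i u := by
  conv_rhs => rw [vec_eq_sum u, map_sum]
  unfold bf
  refine Finset.sum_congr rfl fun j _ => ?_
  rw [map_smul, smul_eq_mul, fn_symm]

theorem bf_invariant (w : W) (u v : B → ℝ) : bf cs (grep cs w u) (grep cs w v) = bf cs u v := by
  induction w using cs.simple_induction_left generalizing u v with
  | one => simp
  | mul_simple_left w i ih =>
    rw [grep_mul, grep_mul, grep_simple, grep_simple, bf_sub_left, bf_sub_right, bf_sub_right,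
      bf_smul_left, bf_smul_right, bf_smul_left, bf_smul_right, bf_right_sroot, bf_sroot, bf_sroot,
      fn_self, ih]
    ring

theorem alt_formula (i j : B) (k : ℕ) :
    Real.sin (Real.pi / ordM cs i j) •
      grep cs (cs.wordProd (CoxeterSystem.alternatingWord i j k)) (sroot i) =
    Real.sin ((k + 1) * (Real.pi / ordM cs i j)) • sroot (if Even k then i else j) +
    Real.sin (k * (Real.pi / ordM cs i j)) • sroot (if Even k then j else i) := by
  induction k with
  | zero => simp [CoxeterSystem.alternatingWord]
  | succ k ih =>
    rw [CoxeterSystem.alternatingWord_succ', cs.wordProd_cons, grep_mul, ← map_smul, ih,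
      grep_simple]
    have hij := fn_sroot cs i j
    have hji : fn cs j (sroot i) = _ := (fn_symm cs j i).trans hij
    generalize Real.pi / ordM cs i j = θ at *
    have e1 : Real.sin ((k + 1) * θ) = Real.sin (k * θ) * Real.cos θ
        + Real.cos (k * θ) * Real.sin θ := by
      rw [← Real.sin_add]; ring_nf
    have e2 : Real.sin ((((k + 1 : ℕ) : ℝ) + 1) * θ) = Real.sin (k * θ) * Real.cos (2 * θ)
        + Real.cos (k * θ) * Real.sin (2 * θ) := by
      rw [← Real.sin_add]; push_cast; ring_nf
    have hs : Real.sin θ ^ 2 = 1 - Real.cos θ ^ 2 := by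
      have := Real.sin_sq_add_cos_sq θ; linarith
    rw [Real.cos_two_mul, Real.sin_two_mul] at e2
    by_cases hk : Even k
    · have hk1 : ¬ Even (k + 1) := by rw [Nat.even_add_one]; simpa using hk
      simp only [hk, hk1, if_true, if_false, map_add, map_smul, hji, hij, fn_self, e2]
      push_cast
      rw [e1]
      simp only [smul_eq_mul]
      match_scalars <;> ring
    · have hk1 : Even (k + 1) := by rw [Nat.even_add_one]; exact hk
      simp only [hk, hk1, if_true, if_false, map_add, map_smul, hji, hij, fn_self, e2]
      push_cast
      rw [e1]
      simp only [smul_eq_mul]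
      match_scalars <;> ring

theorem alt_braid (i j : B) :
    cs.wordProd (CoxeterSystem.alternatingWord i j (ordM cs i j)) =
      cs.wordProd (CoxeterSystem.alternatingWord j i (ordM cs i j)) := by
  have h : (cs.simple i * cs.simple j) ^ (ordM cs i j) = 1 := pow_orderOf_eq_one _
  have hinv : cs.simple j * cs.simple i = (cs.simple i * cs.simple j)⁻¹ := by simp
  rw [cs.prod_alternatingWord_eq_mul_pow, cs.prod_alternatingWord_eq_mul_pow, hinv]
  generalize ordM cs i j = m at *
  rcases Nat.even_or_odd' m with ⟨k, rfl | rfl⟩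
  · simp only [even_two, Even.mul_right, if_true, one_mul, Nat.mul_div_cancel_left k two_pos]
    rw [inv_pow, eq_inv_iff_mul_eq_one, ← pow_add, ← two_mul, h]
  · have hk : ¬ Even (2 * k + 1) := by simp
    have hk2 : (2 * k + 1) / 2 = k := by omega
    simp only [hk, if_false, hk2]
    rw [inv_pow, eq_mul_inv_iff_mul_eq, mul_assoc, ← pow_add, ← cs.simple_mul_simple_cancel_left
      (w := cs.simple j * _) i, ← mul_assoc (cs.simple i) (cs.simple j), ← pow_succ', ← two_mul, h,
      mul_one]

theorem sroot_nonneg (i : B) : 0 ≤ sroot i := by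
  classical
  intro k
  by_cases h : k = i <;> simp [sroot, Pi.single_apply, h]

theorem ordM_pos [Finite W] (i j : B) : 0 < ordM cs i j := orderOf_pos _

theorem grep_pos [Finite W] (n : ℕ) : ∀ (w : W) (i : B), cs.length w = n →
    ¬ cs.IsRightDescent w i → 0 ≤ grep cs w (sroot i) := by
  induction n using Nat.strong_induction_on with
  | _ n IH =>
  intro w i hwn hwi
  by_cases hw1 : w = 1
  · subst hw1; rw [grep_one]; exact sroot_nonneg i
  obtain ⟨j, hj⟩ := cs.exists_rightDescent_of_ne_one hw1
  have hij : i ≠ j := by rintro rfl; exact hwi hj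
  let A := CoxeterSystem.alternatingWord i j
  let Q : ℕ → Prop := fun k => ∃ w', w = w' * cs.wordProd (A k) ∧ cs.length w = cs.length w' + k
  have hlen : ∀ (x : W) k, cs.length (x * cs.wordProd (A k)) ≤ cs.length x + k := by
    intro x k
    refine (cs.length_mul_le _ _).trans ?_
    have := cs.length_wordProd_le (A k)
    rw [CoxeterSystem.length_alternatingWord] at this
    omega
  have hAs : ∀ k, cs.wordProd (A (k + 1)) = cs.simple (if Even k then j else i) * cs.wordProd (A k) := by
    intro k
    change cs.wordProd (CoxeterSystem.alternatingWord i j (k + 1)) = _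
    rw [CoxeterSystem.alternatingWord_succ', cs.wordProd_cons]
  have hQ1 : Q 1 := by
    refine ⟨w * cs.simple j, ?_, ?_⟩
    · simp [A, CoxeterSystem.alternatingWord]
    · exact (cs.isRightDescent_iff.mp hj).symm
  have hQd : ∀ k, Q (k + 1) → Q k := by
    rintro k ⟨w', h1, h2⟩
    rw [hAs, ← mul_assoc] at h1
    refine ⟨_, h1, ?_⟩
    have h3 := hlen (w' * cs.simple (if Even k then j else i)) k
    rw [← h1] at h3
    have h4 := cs.length_mul_le w' (cs.simple (if Even k then j else i))
    rw [cs.length_simple] at h4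
    omega
  have hQd' : ∀ k l, Q (k + l) → Q k := by
    intro k l
    induction l with
    | zero => exact id
    | succ l ih => exact fun h => ih (hQd _ h)
  have hm0 := ordM_pos cs i j
  have hm1 := (ordM_good cs).off i j hij
  have hQm : ¬ Q (ordM cs i j) := by
    rintro ⟨w', h1, h2⟩
    obtain ⟨m', hm'⟩ : ∃ m', ordM cs i j = m' + 1 := ⟨ordM cs i j - 1, by omega⟩
    change w = w' * cs.wordProd (CoxeterSystem.alternatingWord i j _) at h1
    rw [alt_braid, hm', CoxeterSystem.alternatingWord_succ, cs.wordProd_concat, ← mul_assoc] at h1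
    have h3 : w * cs.simple i = w' * cs.wordProd (A m') := by
      rw [h1, cs.simple_mul_simple_cancel_right]
    have h4 := hlen w' m'
    rw [← h3] at h4
    apply hwi
    unfold CoxeterSystem.IsRightDescent
    omega
  -- maximal k
  obtain ⟨k, hk1, hkQ, hkn⟩ : ∃ k, 1 ≤ k ∧ Q k ∧ ¬ Q (k + 1) := by
    by_contra hcon
    push Not at hcon
    have : ∀ k, Q (k + 1) := by
      intro k
      induction k with
      | zero => exact hQ1
      | succ k ih => exact hcon _ (by omega) ih
    have := this (ordM cs i j - 1)
    rw [Nat.sub_add_cancel hm0] at this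
    exact hQm this
  have hkm : k < ordM cs i j := by
    by_contra hcon
    push Not at hcon
    apply hQm
    apply hQd' _ (k - ordM cs i j)
    rwa [Nat.add_sub_cancel' hcon]
  obtain ⟨w', h1, h2⟩ := hkQ
  have hnext : ¬ cs.IsRightDescent w' (if Even k then j else i) := by
    intro hd
    apply hkn
    refine ⟨w' * cs.simple (if Even k then j else i), ?_, ?_⟩
    · rw [hAs, ← mul_assoc, cs.simple_mul_simple_cancel_right, ← h1]
    · have := cs.isRightDescent_iff.mp hd
      omega
  have hother : ¬ cs.IsRightDescent w' (if Even k then i else j) := by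
    intro hd
    obtain ⟨k', rfl⟩ : ∃ k', k = k' + 1 := ⟨k - 1, by omega⟩
    have he : (if Even (k' + 1) then i else j) = (if Even k' then j else i) := by
      by_cases h : Even k'
      · have : ¬ Even (k' + 1) := by rw [Nat.even_add_one]; simpa using h
        simp only [h, this, if_true, if_false]
      · have : Even (k' + 1) := by rw [Nat.even_add_one]; exact h
        simp only [h, this, if_true, if_false]
    rw [he] at hd
    rw [hAs, ← mul_assoc] at h1
    have h3 := hlen (w' * cs.simple (if Even k' then j else i)) k'
    rw [← h1] at h3
    have := cs.isRightDescent_iff.mp hd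
    omega
  have p1 := IH (cs.length w') (by omega) w' _ rfl hnext
  have p2 := IH (cs.length w') (by omega) w' _ rfl hother
  have hm2 : (2 : ℝ) ≤ ordM cs i j := by
    have : 2 ≤ ordM cs i j := by omega
    exact_mod_cast this
  have hs : 0 < Real.sin (Real.pi / ordM cs i j) := by
    apply Real.sin_pos_of_pos_of_lt_pi (by positivity)
    rw [div_lt_iff₀ (by positivity)]
    nlinarith [Real.pi_pos]
  have key : Real.sin (Real.pi / ordM cs i j) • grep cs w (sroot i) =
    Real.sin ((k + 1) * (Real.pi / ordM cs i j)) • grep cs w' (sroot (if Even k then i else j)) +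
    Real.sin (k * (Real.pi / ordM cs i j)) • grep cs w' (sroot (if Even k then j else i)) := by
    rw [h1, grep_mul, ← map_smul, alt_formula, map_add, map_smul, map_smul]
  have hkm' : (k : ℝ) + 1 ≤ ordM cs i j := by exact_mod_cast hkm
  have s1 : 0 ≤ Real.sin ((k + 1) * (Real.pi / ordM cs i j)) := by
    apply Real.sin_nonneg_of_nonneg_of_le_pi (by positivity)
    rw [← mul_div_assoc, div_le_iff₀ (by positivity)]
    nlinarith [Real.pi_pos]
  have s2 : 0 ≤ Real.sin (k * (Real.pi / ordM cs i j)) := by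
    apply Real.sin_nonneg_of_nonneg_of_le_pi (by positivity)
    rw [← mul_div_assoc, div_le_iff₀ (by positivity)]
    nlinarith [Real.pi_pos]
  have hfin : 0 ≤ Real.sin (Real.pi / ordM cs i j) • grep cs w (sroot i) := by
    rw [key]
    exact add_nonneg (smul_nonneg s1 p2) (smul_nonneg s2 p1)
  intro l
  have := hfin l
  simp only [Pi.zero_apply, Pi.smul_apply, smul_eq_mul] at this ⊢
  exact nonneg_of_mul_nonneg_right this hs

theorem bf_nonneg {u v : B → ℝ} (hu : 0 ≤ u) (hv : ∀ i, 0 ≤ fn cs i v) : 0 ≤ bf cs u v :=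
  Finset.sum_nonneg fun i _ => mul_nonneg (hu i) (hv i)

theorem stab_mem [Finite W] (v : B → ℝ) (hv : ∀ i, 0 ≤ fn cs i v) (K : Set B)
    (hK : ∀ i, fn cs i v = 0 → i ∈ K) (n : ℕ) :
    ∀ w : W, cs.length w = n → grep cs w v = v → w ∈ Subgroup.closure (cs.simple '' K) := by
  induction n using Nat.strong_induction_on with
  | _ n IH =>
  intro w hn hw
  by_cases hw1 : w = 1
  · subst hw1; exact one_mem _
  obtain ⟨i, hi⟩ := cs.exists_rightDescent_of_ne_one hw1
  have hi' := cs.isRightDescent_iff_not_isRightDescent_mul.mp hi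
  have hpos := grep_pos cs _ (w * cs.simple i) i rfl hi'
  have h0 : grep cs (w * cs.simple i) (sroot i) = - grep cs w (sroot i) := by
    rw [grep_mul, grep_simple, fn_self, ← map_neg]
    congr 1
    module
  have h1 := bf_nonneg cs hpos hv
  have h2 : bf cs (grep cs w (sroot i)) v = fn cs i v := by
    conv_lhs => rw [← hw]
    rw [bf_invariant, bf_sroot]
  have h3 : bf cs (grep cs (w * cs.simple i) (sroot i)) v = - fn cs i v := by
    rw [h0, ← h2, ← neg_one_smul ℝ, bf_smul_left, neg_one_mul]
  have h4 : fn cs i v = 0 := le_antisymm (by linarith) (hv i)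
  have h5 : grep cs (w * cs.simple i) v = v := by
    rw [grep_mul, grep_simple, h4, zero_smul, sub_zero, hw]
  have hmem := IH _ (by rw [← hn]; exact hi) _ rfl h5
  rw [← cs.simple_mul_simple_cancel_right (w := w) i]
  exact mul_mem hmem (Subgroup.subset_closure ⟨i, hK i h4, rfl⟩)

theorem grep_fix {v : B → ℝ} {K : Set B} (h : ∀ i ∈ K, fn cs i v = 0) {w : W}
    (hw : w ∈ Subgroup.closure (cs.simple '' K)) : grep cs w v = v := by
  induction hw using Subgroup.closure_induction with
  | mem x hx =>
    obtain ⟨i, hi, rfl⟩ := hx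
    rw [grep_simple, h i hi, zero_smul, sub_zero]
  | one => exact grep_one cs v
  | mul x y _ _ hx hy => rw [grep_mul, hy, hx]
  | inv x _ hx =>
    conv_lhs => rw [← hx]
    rw [← grep_mul, inv_mul_cancel, grep_one]

theorem nondeg [Finite W] {v : B → ℝ} (h : ∀ i, fn cs i v = 0) : v = 0 := by
  classical
  have := Fintype.ofFinite W
  have hfix : ∀ w, grep cs w v = v := by
    intro w
    refine grep_fix cs (K := Set.univ) (fun i _ => h i) ?_
    rw [Set.image_univ, cs.subgroup_closure_range_simple]
    trivial
  have hz : ∀ i, ∑ w, grep cs w (sroot i) = 0 := by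
    intro i
    have e : ∑ w, grep cs w (sroot i) = ∑ w, grep cs (w * cs.simple i) (sroot i) :=
      (Equiv.sum_comp (Equiv.mulRight (cs.simple i)) (fun w => grep cs w (sroot i))).symm
    have e2 : ∑ w, grep cs (w * cs.simple i) (sroot i) = - ∑ w, grep cs w (sroot i) := by
      rw [← Finset.sum_neg_distrib]
      refine Finset.sum_congr rfl fun w _ => ?_
      rw [grep_mul, grep_simple, fn_self, ← map_neg]
      congr 1
      module
    rw [e2] at e
    exact self_eq_neg.mp e
  have h1 : ∑ w, grep cs w v = 0 := by
    have : ∀ w, grep cs w v = ∑ i, v i • grep cs w (sroot i) := by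
      intro w
      conv_lhs => rw [vec_eq_sum v, map_sum]
      simp only [map_smul]
    simp only [this]
    rw [Finset.sum_comm]
    simp only [← Finset.smul_sum, hz, smul_zero, Finset.sum_const_zero]
  simp only [hfix, Finset.sum_const, Finset.card_univ] at h1
  rw [← Nat.cast_smul_eq_nsmul ℝ] at h1
  exact (smul_eq_zero.mp h1).resolve_left (by exact_mod_cast Fintype.card_ne_zero)

theorem exists_weight [Finite W] (t : B → ℝ) : ∃ v : B → ℝ, ∀ i, fn cs i v = t i := by
  have hinj : Function.Injective (LinearMap.pi (fn cs)) := by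
    rw [← LinearMap.ker_eq_bot, LinearMap.ker_eq_bot']
    intro v hv
    exact nondeg cs fun i => congrFun hv i
  obtain ⟨v, hv⟩ := LinearMap.injective_iff_surjective.mp hinj t
  exact ⟨v, fun i => congrFun hv i⟩

theorem fn_ext [Finite W] {u v : B → ℝ} (h : ∀ i, fn cs i u = fn cs i v) : u = v := by
  rw [← sub_eq_zero]
  exact nondeg cs fun i => by rw [map_sub, h, sub_self]

theorem grep_faithful [Finite W] {w : W} (h : ∀ v, grep cs w v = v) : w = 1 := by
  obtain ⟨v, hv⟩ := exists_weight cs (fun _ => 1)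
  have := stab_mem cs v (fun i => by rw [hv]; norm_num) ∅ (fun i hi => by rw [hv] at hi; norm_num at hi)
    _ w rfl (h v)
  simpa using this

theorem orb_refl (σB : Equiv.Perm B) (i : B) : SameOrbit σB i i := ⟨0, by simp⟩

theorem orb_symm {σB : Equiv.Perm B} {i j : B} (h : SameOrbit σB i j) : SameOrbit σB j i := by
  obtain ⟨n, rfl⟩ := h
  exact ⟨-n, by simp⟩

theorem orb_step {σB : Equiv.Perm B} {i j : B} : SameOrbit σB i (σB j) ↔ SameOrbit σB i j := by
  constructor
  · rintro ⟨n, hn⟩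
    refine ⟨-1 + n, ?_⟩
    rw [zpow_add, Equiv.Perm.mul_apply, hn]
    simp
  · rintro ⟨n, hn⟩
    refine ⟨1 + n, ?_⟩
    rw [zpow_add, Equiv.Perm.mul_apply, hn]
    simp

open Classical in
theorem pairwise_of_count (σB : Equiv.Perm B) (l : List B)
    (h : ∀ j ∈ l, l.countP (fun i => decide (SameOrbit σB i j)) ≤ 1) :
    l.Pairwise (fun i j => ¬ SameOrbit σB i j) := by
  induction l with
  | nil => exact List.Pairwise.nil
  | cons a l ih =>
    refine List.Pairwise.cons ?_ (ih ?_)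
    · intro b hb hab
      have := h a (by simp)
      rw [List.countP_cons_of_pos (by simpa using orb_refl σB a)] at this
      have h0 : l.countP (fun i => decide (SameOrbit σB i a)) = 0 := by omega
      rw [List.countP_eq_zero] at h0
      exact h0 b hb (by simpa using orb_symm hab)
    · intro j hj
      refine le_trans ?_ (h j (by simp [hj]))
      rw [List.countP_cons]
      omega

/-- Twist of vectors by the diagram automorphism. -/
def tw (σB : Equiv.Perm B) (v : B → ℝ) : B → ℝ := fun k => v (σB.symm k)

open Classical in
/-- Orbit sum functional. -/
noncomputable def osum (σB : Equiv.Perm B) (i : B) (v : B → ℝ) : ℝ :=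
  ∑ k, if SameOrbit σB i k then v k else 0

open Classical in
theorem osum_tw (σB : Equiv.Perm B) (i : B) (v : B → ℝ) :
    osum σB i (tw σB v) = osum σB i v := by
  unfold osum
  rw [← Equiv.sum_comp σB]
  refine Finset.sum_congr rfl fun k _ => ?_
  have h1 : tw σB v (σB k) = v k := by simp [tw]
  rw [h1]
  exact if_congr orb_step rfl rfl

theorem osum_sub (σB : Equiv.Perm B) (i : B) (u v : B → ℝ) :
    osum σB i (u - v) = osum σB i u - osum σB i v := by
  unfold osum
  rw [← Finset.sum_sub_distrib]
  refine Finset.sum_congr rfl fun k _ => ?_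
  split_ifs <;> simp

open Classical in
theorem osum_smul_sroot (σB : Equiv.Perm B) (i j : B) (a : ℝ) :
    osum σB i (a • sroot j) = if SameOrbit σB i j then a else 0 := by
  unfold osum
  rw [Finset.sum_eq_single j]
  · simp [sroot]
  · intro k _ hk
    simp [sroot, Pi.single_apply, hk]
  · simp

theorem osum_word (σB : Equiv.Perm B) (i : B) (l : List B) (hl : ∀ k ∈ l, ¬ SameOrbit σB i k)
    (v : B → ℝ) : osum σB i (grep cs (cs.wordProd l) v) = osum σB i v := by
  induction l with
  | nil => simp
  | cons a l ih =>
    rw [cs.wordProd_cons, grep_mul, grep_simple, osum_sub, osum_smul_sroot,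
      if_neg (hl a (by simp)), sub_zero, ih (fun k hk => hl k (by simp [hk]))]

theorem word_mem (l : List B) (K : Set B) (h : ∀ i ∈ l, i ∈ K) :
    cs.wordProd l ∈ Subgroup.closure (cs.simple '' K) := by
  induction l with
  | nil => simp
  | cons a l ih =>
    rw [cs.wordProd_cons]
    exact mul_mem (Subgroup.subset_closure ⟨a, h a (by simp), rfl⟩)
      (ih fun i hi => h i (by simp [hi]))

theorem coxfix (σB : Equiv.Perm B) (l : List B) (hl : l.Pairwise (fun i j => ¬ SameOrbit σB i j))
    (v : B → ℝ) (h : ∀ i ∈ l, osum σB i (grep cs (cs.wordProd l) v) = osum σB i v) :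
    ∀ i ∈ l, fn cs i v = 0 := by
  induction l with
  | nil => simp
  | cons a l ih =>
    rw [List.pairwise_cons] at hl
    have ha := h a (by simp)
    rw [cs.wordProd_cons, grep_mul, grep_simple, osum_sub, osum_smul_sroot,
      if_pos (orb_refl σB a), osum_word cs σB a l hl.1] at ha
    have h0 : fn cs a (grep cs (cs.wordProd l) v) = 0 := by linarith
    have h1 : grep cs (cs.wordProd (a :: l)) v = grep cs (cs.wordProd l) v := by
      rw [cs.wordProd_cons, grep_mul, grep_simple, h0, zero_smul, sub_zero]
    have h2 := ih hl.2 (fun i hi => by rw [← h1]; exact h i (by simp [hi]))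
    have h3 : grep cs (cs.wordProd l) v = v :=
      grep_fix cs (K := {i | i ∈ l}) h2 (word_mem cs l _ fun i hi => hi)
    intro i hi
    rcases List.mem_cons.mp hi with rfl | hi
    · rw [h3] at h0; exact h0
    · exact h2 i hi

section Twist
variable (σB : Equiv.Perm B) (σW : W ≃* W) (hσ : ∀ i, σW (cs.simple i) = cs.simple (σB i))
include hσ

theorem fn_tw (i : B) (v : B → ℝ) : fn cs (σB i) (tw σB v) = fn cs i v := by
  unfold fn
  rw [scoroot_apply, scoroot_apply, ← Equiv.sum_comp σB]
  refine Finset.sum_congr rfl fun j _ => ?_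
  have : ordM cs (σB i) (σB j) = ordM cs i j := by
    unfold ordM
    rw [← hσ, ← hσ, ← map_mul]
    exact MulEquiv.orderOf_eq σW _
  rw [this]
  simp [tw]

theorem tw_grep (w : W) (v : B → ℝ) : tw σB (grep cs w v) = grep cs (σW w) (tw σB v) := by
  induction w using cs.simple_induction_left generalizing v with
  | one => simp
  | mul_simple_left w i ih =>
    rw [map_mul σW, grep_mul, grep_mul, hσ, grep_simple, grep_simple, ← ih, fn_tw cs σB σW hσ]
    funext k
    have : sroot i (σB.symm k) = sroot (σB i) k := by
      classical
      simp [sroot, Pi.single_apply, Equiv.symm_apply_eq]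
    simp [tw, this]

open Classical in
theorem conj_sub [Finite W] (K₁ K₂ : Set B) (hK₂ : ∀ i ∈ K₂, σB i ∈ K₂)
    (l₁ : List B) (hl₁K : ∀ i ∈ l₁, i ∈ K₁)
    (hl₁orb : ∀ j ∈ K₁, l₁.countP (fun i => decide (SameOrbit σB i j)) = 1)
    (c₂ : W) (hc₂ : c₂ ∈ Subgroup.closure (cs.simple '' K₂))
    (w : W) (hw : cs.wordProd l₁ * σW w = w * c₂) :
    ∀ u ∈ Subgroup.closure (cs.simple '' K₁), w⁻¹ * u * w ∈ Subgroup.closure (cs.simple '' K₂) := by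
  have hK₂' : ∀ i, σB i ∈ K₂ ↔ i ∈ K₂ := by
    intro i
    refine ⟨fun h => ?_, hK₂ i⟩
    have hinj : Function.Injective (fun k : K₂ => (⟨σB k, hK₂ k k.2⟩ : K₂)) := by
      intro k k' hkk
      exact Subtype.ext (σB.injective (congrArg Subtype.val hkk))
    obtain ⟨k, hk⟩ := Finite.surjective_of_injective hinj ⟨σB i, h⟩
    have hki : (k : B) = i := σB.injective (congrArg Subtype.val hk)
    rw [← hki]
    exact k.2
  obtain ⟨v, hv⟩ := exists_weight cs (fun i => if i ∈ K₂ then 0 else 1)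
  have htv : tw σB v = v := by
    apply fn_ext cs
    intro i
    obtain ⟨k, rfl⟩ := σB.surjective i
    rw [fn_tw cs σB σW hσ, hv, hv]
    simp only [hK₂']
  have hfixv : ∀ x ∈ Subgroup.closure (cs.simple '' K₂), grep cs x v = v := fun x hx =>
    grep_fix cs (fun i hi => by rw [hv, if_pos hi]) hx
  have h1 : tw σB (grep cs w v) = grep cs (σW w) v := by
    rw [tw_grep cs σB σW hσ, htv]
  have h2 : grep cs (cs.wordProd l₁) (grep cs (σW w) v) = grep cs w v := by
    rw [← grep_mul, hw, grep_mul, hfixv _ hc₂]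
  have h3 : ∀ i ∈ l₁, fn cs i (grep cs (σW w) v) = 0 := by
    apply coxfix cs σB l₁ (pairwise_of_count σB l₁ fun j hj => (hl₁orb j (hl₁K j hj)).le)
    intro i _
    rw [h2, ← h1, osum_tw]
  have h4 : grep cs (cs.wordProd l₁) (grep cs (σW w) v) = grep cs (σW w) v :=
    grep_fix cs (K := {i | i ∈ l₁}) h3 (word_mem cs l₁ _ fun i hi => hi)
  have h5 : grep cs (σW w) v = grep cs w v := h4.symm.trans h2
  rw [h5] at h1 h3
  have h6 : ∀ i, fn cs (σB i) (grep cs w v) = fn cs i (grep cs w v) := by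
    intro i
    conv_lhs => rw [← h1]
    exact fn_tw cs σB σW hσ _ _
  have h7 : ∀ (n : ℤ) i, fn cs ((σB ^ n) i) (grep cs w v) = fn cs i (grep cs w v) := by
    intro n
    induction n using Int.induction_on with
    | zero => simp
    | succ n ih =>
      intro i
      rw [zpow_add, zpow_one, Equiv.Perm.mul_apply, ih, h6]
    | pred n ih =>
      intro i
      rw [sub_eq_add_neg, zpow_add, zpow_neg_one, Equiv.Perm.mul_apply, ih, ← h6]
      simp
  have h8 : ∀ j ∈ K₁, fn cs j (grep cs w v) = 0 := by
    intro j hj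
    have : 0 < l₁.countP (fun i => decide (SameOrbit σB i j)) := by rw [hl₁orb j hj]; norm_num
    rw [List.countP_pos_iff] at this
    obtain ⟨i, hi, hij⟩ := this
    obtain ⟨n, rfl⟩ := of_decide_eq_true hij
    rw [h7, h3 i hi]
  intro u hu
  refine stab_mem cs v (fun i => ?_) K₂ (fun i hi => ?_) _ _ rfl ?_
  · rw [hv]; split_ifs <;> norm_num
  · rw [hv] at hi
    by_contra hcon
    simp [hcon] at hi
  · rw [grep_mul, grep_mul, grep_fix cs h8 hu, ← grep_mul, inv_mul_cancel, grep_one]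

end Twist

theorem grep_supp {K : Set B} {u : W} (hu : u ∈ Subgroup.closure (cs.simple '' K)) :
    ∀ (v : B → ℝ) (k : B), k ∉ K → grep cs u v k = v k := by
  induction hu using Subgroup.closure_induction with
  | mem x hx =>
    obtain ⟨i, hi, rfl⟩ := hx
    intro v k hk
    have : k ≠ i := by rintro rfl; exact hk hi
    simp [grep_simple, sroot, this]
  | one => intro v k _; rw [grep_one]
  | mul x y _ _ hx hy => intro v k hk; rw [grep_mul, hx _ _ hk, hy _ _ hk]
  | inv x _ hx =>
    intro v k hk
    rw [← hx (grep cs x⁻¹ v) _ hk, ← grep_mul, mul_inv_cancel, grep_one]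

theorem root_supp {K : Set B} {x : W} {j : B}
    (h : x * cs.simple j * x⁻¹ ∈ Subgroup.closure (cs.simple '' K)) (k : B) (hk : k ∉ K) :
    grep cs x (sroot j) k = 0 := by
  have h1 := grep_supp cs h (grep cs x (sroot j)) k hk
  have h2 : grep cs (x * cs.simple j * x⁻¹) (grep cs x (sroot j)) = - grep cs x (sroot j) := by
    rw [← grep_mul, inv_mul_cancel_right, grep_mul, grep_simple, fn_self, ← map_neg]
    congr 1
    module
  rw [h2, Pi.neg_apply] at h1
  linarith

theorem mono_lemma [Finite W] (x : W) (K₁ K₂ : Set B)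
    (hp : ∀ j ∈ K₂, 0 ≤ grep cs x (sroot j))
    (hs : ∀ j ∈ K₂, ∀ k, k ∉ K₁ → grep cs x (sroot j) k = 0)
    (hp' : ∀ i ∈ K₁, 0 ≤ grep cs x⁻¹ (sroot i)) :
    ∀ j ∈ K₂, ∃ i ∈ K₁, x * cs.simple j * x⁻¹ = cs.simple i := by
  classical
  intro j hj
  obtain ⟨a, ha⟩ : ∃ a, a = grep cs x (sroot j) := ⟨_, rfl⟩
  have hinv : grep cs x⁻¹ a = sroot j := by rw [ha, ← grep_mul, inv_mul_cancel, grep_one]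
  have hsum : sroot j = ∑ i, a i • grep cs x⁻¹ (sroot i) := by
    conv_lhs => rw [← hinv, vec_eq_sum a, map_sum]
    simp only [map_smul]
  have ha0 : ∃ i, a i ≠ 0 := by
    by_contra hcon
    push Not at hcon
    have : a = 0 := funext hcon
    rw [this, map_zero] at hinv
    have := congrFun hinv j
    simp [sroot] at this
  obtain ⟨i, hi0⟩ := ha0
  have hiK : i ∈ K₁ := by
    by_contra hcon
    exact hi0 (by rw [ha]; exact hs j hj i hcon)
  have hk : ∀ k, k ≠ j → grep cs x⁻¹ (sroot i) k = 0 := by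
    intro k hkj
    have h1 := congrFun hsum k
    rw [Finset.sum_apply] at h1
    have h2 : sroot j k = 0 := by simp [sroot, hkj]
    rw [h2] at h1
    have h3 := (Finset.sum_eq_zero_iff_of_nonneg (fun i' _ => ?_)).mp h1.symm i (Finset.mem_univ i)
    · simpa [hi0] using h3
    · by_cases hi' : i' ∈ K₁
      · have q1 := hp j hj i'
        have q2 := hp' i' hi' k
        rw [← ha] at q1
        exact mul_nonneg q1 q2
      · have : a i' = 0 := by rw [ha]; exact hs j hj i' hi'
        simp [this]
  obtain ⟨b, hb⟩ : ∃ b, b = grep cs x⁻¹ (sroot i) j := ⟨_, rfl⟩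
  have hxi : grep cs x⁻¹ (sroot i) = b • sroot j := by
    funext k
    by_cases hkj : k = j
    · subst hkj; simp [sroot, hb]
    · rw [hk k hkj]; simp [sroot, hkj]
  have hb0 : 0 ≤ b := by rw [hb]; exact hp' i hiK j
  have hbb : b * b = 1 := by
    have h1 := bf_invariant cs x⁻¹ (sroot i) (sroot i)
    rw [hxi, bf_smul_left, bf_smul_right, bf_sroot, bf_sroot, fn_self, fn_self] at h1
    linarith
  have hb1 : b = 1 := by nlinarith
  rw [hb1, one_smul] at hxi
  have hxj : grep cs x (sroot j) = sroot i := by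
    rw [← hxi, ← grep_mul, mul_inv_cancel, grep_one]
  refine ⟨i, hiK, ?_⟩
  rw [← mul_inv_eq_one, cs.inv_simple]
  apply grep_faithful cs
  have main : ∀ v, grep cs (x * cs.simple j * x⁻¹) v = grep cs (cs.simple i) v := by
    intro v
    have h1 : fn cs j (grep cs x⁻¹ v) = fn cs i v := by
      rw [← bf_sroot, ← hxi, bf_invariant, bf_sroot]
    rw [grep_mul, grep_mul, grep_simple, grep_simple, map_sub, map_smul, hxj, h1, ← grep_mul,
      mul_inv_cancel, grep_one]
  intro v
  rw [grep_mul, main, ← grep_mul, cs.simple_mul_simple_self, grep_one]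

end Geom

open Classical in
/-- Let `(W_e, Δ_e)` be a finite Coxeter system with diagram automorphism
`σ_I`, let `K₁, K₂ ⊆ Δ_e` be `σ_I`-stable, and let `c₁, c₂` be `σ_I`-Coxeter elements of
the standard parabolic subgroups `W_{K₁}, W_{K₂}` (given by reduced words `l₁, l₂` with
letters in `K₁` resp. `K₂` hitting each `σ_I`-orbit of `K₁` resp. `K₂` exactly once).
If `w ∈ W_e` satisfies `c₁ σ_I(w) = w c₂`, then there is a minimal-length double coset
representative `x ∈ {}^{K₁}W_e{}^{K₂}` with `x K₂ x⁻¹ = K₁` and `w ∈ x W_{K₂}`. -/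
theorem stmt2 {B : Type*} [Fintype B] {W : Type*} [Group W] [Finite W]
    {M : CoxeterMatrix B} (cs : CoxeterSystem M W)
    (σB : Equiv.Perm B) (σW : W ≃* W)
    (hσ : ∀ i, σW (cs.simple i) = cs.simple (σB i))
    (K₁ K₂ : Set B)
    (hK₁ : ∀ i ∈ K₁, σB i ∈ K₁) (hK₂ : ∀ i ∈ K₂, σB i ∈ K₂)
    (l₁ l₂ : List B)
    (hl₁K : ∀ i ∈ l₁, i ∈ K₁) (hl₂K : ∀ i ∈ l₂, i ∈ K₂)
    (hl₁red : cs.IsReduced l₁) (hl₂red : cs.IsReduced l₂)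
    (hl₁orb : ∀ j ∈ K₁, l₁.countP (fun i => decide (SameOrbit σB i j)) = 1)
    (hl₂orb : ∀ j ∈ K₂, l₂.countP (fun i => decide (SameOrbit σB i j)) = 1)
    (c₁ c₂ : W) (hc₁ : c₁ = cs.wordProd l₁) (hc₂ : c₂ = cs.wordProd l₂)
    (w : W) (hw : c₁ * σW w = w * c₂) :
    ∃ x : W,
      -- x is a minimal length element of W_{K₁} x W_{K₂}
      (∀ u ∈ Subgroup.closure (cs.simple '' K₁), ∀ v ∈ Subgroup.closure (cs.simple '' K₂),
        cs.length x ≤ cs.length (u * x * v)) ∧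
      -- x K₂ x⁻¹ = K₁
      (∀ j ∈ K₂, ∃ i ∈ K₁, x * cs.simple j * x⁻¹ = cs.simple i) ∧
      (∀ i ∈ K₁, ∃ j ∈ K₂, x * cs.simple j * x⁻¹ = cs.simple i) ∧
      -- w ∈ x W_{K₂}
      (∃ v ∈ Subgroup.closure (cs.simple '' K₂), w = x * v) := by
  have hmem₁ : c₁ ∈ Subgroup.closure (cs.simple '' K₁) := hc₁ ▸ word_mem cs l₁ K₁ hl₁K
  have hmem₂ : c₂ ∈ Subgroup.closure (cs.simple '' K₂) := hc₂ ▸ word_mem cs l₂ K₂ hl₂K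
  have hA := conj_sub cs σB σW hσ K₁ K₂ hK₂ l₁ hl₁K hl₁orb c₂ hmem₂ w (by rw [← hc₁]; exact hw)
  have hB := conj_sub cs σB σW hσ K₂ K₁ hK₁ l₂ hl₂K hl₂orb c₁ hmem₁ w⁻¹ (by
    rw [← hc₂, map_inv, mul_inv_eq_iff_eq_mul, mul_assoc, hw, inv_mul_cancel_left])
  obtain ⟨x, ⟨v₀, hv₀, rfl⟩, hmin⟩ := Set.exists_min_image
    {y : W | ∃ v ∈ Subgroup.closure (cs.simple '' K₂), y = w * v} cs.length (Set.toFinite _)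
    ⟨w, 1, one_mem _, by simp⟩
  obtain ⟨x, hx⟩ : ∃ x, x = w * v₀ := ⟨_, rfl⟩
  rw [← hx] at hmin
  have hA' : ∀ u ∈ Subgroup.closure (cs.simple '' K₁),
      x⁻¹ * u * x ∈ Subgroup.closure (cs.simple '' K₂) := by
    intro u hu
    have : x⁻¹ * u * x = v₀⁻¹ * (w⁻¹ * u * w) * v₀ := by rw [hx]; group
    rw [this]
    exact mul_mem (mul_mem (inv_mem hv₀) (hA u hu)) hv₀
  have hB' : ∀ v ∈ Subgroup.closure (cs.simple '' K₂),
      x * v * x⁻¹ ∈ Subgroup.closure (cs.simple '' K₁) := by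
    intro v hv
    have : x * v * x⁻¹ = w⁻¹⁻¹ * (v₀ * v * v₀⁻¹) * w⁻¹ := by rw [hx]; group
    rw [this]
    exact hB _ (mul_mem (mul_mem hv₀ hv) (inv_mem hv₀))
  have hmin' : ∀ v ∈ Subgroup.closure (cs.simple '' K₂), cs.length x ≤ cs.length (x * v) := by
    intro v hv
    exact hmin _ ⟨v₀ * v, mul_mem hv₀ hv, by rw [hx, mul_assoc]⟩
  have hmin₂ : ∀ u ∈ Subgroup.closure (cs.simple '' K₁),
      ∀ v ∈ Subgroup.closure (cs.simple '' K₂), cs.length x ≤ cs.length (u * x * v) := by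
    intro u hu v hv
    have : u * x * v = x * (x⁻¹ * u * x * v) := by group
    rw [this]
    exact hmin' _ (mul_mem (hA' u hu) hv)
  have hs₁ : ∀ i ∈ K₁, cs.simple i ∈ Subgroup.closure (cs.simple '' K₁) :=
    fun i hi => Subgroup.subset_closure ⟨i, hi, rfl⟩
  have hs₂ : ∀ i ∈ K₂, cs.simple i ∈ Subgroup.closure (cs.simple '' K₂) :=
    fun i hi => Subgroup.subset_closure ⟨i, hi, rfl⟩
  have hp : ∀ j ∈ K₂, 0 ≤ grep cs x (sroot j) := by
    intro j hj
    refine grep_pos cs _ x j rfl ?_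
    unfold CoxeterSystem.IsRightDescent
    exact not_lt.mpr (hmin' _ (hs₂ j hj))
  have hp' : ∀ i ∈ K₁, 0 ≤ grep cs x⁻¹ (sroot i) := by
    intro i hi
    refine grep_pos cs _ x⁻¹ i rfl ?_
    rw [cs.isRightDescent_inv_iff]
    unfold CoxeterSystem.IsLeftDescent
    have := hmin₂ _ (hs₁ i hi) 1 (one_mem _)
    rw [mul_one] at this
    exact not_lt.mpr this
  have hsup : ∀ j ∈ K₂, ∀ k, k ∉ K₁ → grep cs x (sroot j) k = 0 :=
    fun j hj k hk => root_supp cs (hB' _ (hs₂ j hj)) k hk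
  have hsup' : ∀ i ∈ K₁, ∀ k, k ∉ K₂ → grep cs x⁻¹ (sroot i) k = 0 :=
    fun i hi k hk => root_supp cs (by rw [inv_inv]; exact hA' _ (hs₁ i hi)) k hk
  refine ⟨x, hmin₂, mono_lemma cs x K₁ K₂ hp hsup hp', ?_, v₀⁻¹, inv_mem hv₀, by rw [hx]; group⟩
  intro i hi
  obtain ⟨j, hj, hji⟩ := mono_lemma cs x⁻¹ K₂ K₁ hp' hsup' (by rw [inv_inv]; exact hp) i hi
  refine ⟨j, hj, ?_⟩
  rw [← hji]
  group
end

section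
/- Let W be a finite Coxeter group with diagram automorphism σ and let c' ∈ W be a partial σ-Coxeter element, i.e., a σ-Coxeter element of W_K for some σ-stable subset K of the simple roots. Then c' has minimal length in its σ-conjugacy class: for every x ∈ W, ℓ(x^{-1} c' σ(x)) ≥ ℓ(c'). -/
namespace PCox

/-- The entry of the (doubled) Gram matrix. -/
noncomputable def cf {B : Type*} (m : B → B → ℕ) (i j : B) : ℝ :=
  -2 * Real.cos (Real.pi / m i j)

/-- The linear form attached to a simple root. -/
noncomputable def fm {B : Type*} [Fintype B] (m : B → B → ℕ) (i : B) : Module.Dual ℝ (B → ℝ) :=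
  ∑ j, cf m i j • LinearMap.proj j

lemma fm_apply {B : Type*} [Fintype B] (m : B → B → ℕ) (i : B) (v : B → ℝ) :
    fm m i v = ∑ j, cf m i j * v j := by
  simp [fm]

open Classical in
lemma fm_single {B : Type*} [Fintype B] (m : B → B → ℕ) (i j : B) :
    fm m i (Pi.single j 1) = cf m i j := by
  rw [fm_apply]
  simp [Pi.single_apply]

open Polynomial.Chebyshev in
lemma refl_pow {V : Type*} [AddCommGroup V] [Module ℝ V] {x y : V} {f g : Module.Dual ℝ V}
    (hf : f x = 2) (hg : g y = 2) (m : ℕ) (hm : m ≠ 1)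
    (h1 : f y = -2 * Real.cos (Real.pi / m)) (h2 : g x = -2 * Real.cos (Real.pi / m)) :
    (Module.reflection hf * Module.reflection hg) ^ m = 1 := by
  ext z
  have ht : 2 * Real.cos (2 * Real.pi / m) = f y * g x - 2 := by
    rw [h1, h2, mul_div_assoc, Real.cos_two_mul]; ring
  rcases Nat.eq_zero_or_pos m with rfl | hpos
  · simp
  rw [Module.reflection_mul_reflection_pow_apply hf hg m z _ ht]
  by_cases hm2 : m = 2
  · subst hm2
    have e1 : f y = 0 := by rw [h1]; simp
    have e2 : g x = 0 := by rw [h2]; simp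
    norm_num [e1, e2]
    module
  have hm3 : 3 ≤ m := by omega
  have hmR : (3 : ℝ) ≤ m := by exact_mod_cast hm3
  set θ := 2 * Real.pi / m with hθ
  have hmθ : m * θ = 2 * Real.pi := by rw [hθ]; field_simp
  have hs : Real.sin θ ≠ 0 := by
    apply ne_of_gt
    apply Real.sin_pos_of_pos_of_lt_pi
    · positivity
    · rw [hθ, div_lt_iff₀ (by positivity)]
      nlinarith [Real.pi_pos]
  rcases Nat.even_or_odd' m with ⟨k, hk | hk⟩
  · have e1 : ((m : ℤ) - 2) / 2 = k - 1 := by omega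
    have e2 : ((m : ℤ) - 1) / 2 = k - 1 := by omega
    have e3 : (S ℝ ((k : ℤ) - 1)).eval (2 * Real.cos θ) = 0 := by
      have := S_two_mul_real_cos θ ((k : ℤ) - 1)
      have h : Real.sin ((((k : ℤ) - 1 : ℤ) + 1 : ℝ) * θ) = 0 := by
        rw [← Real.sin_pi]; congr 1; push_cast
        subst hk; push_cast at hmθ; linarith
      rw [h] at this
      exact (mul_eq_zero.mp this).resolve_right hs
    rw [e1, e2, e3]; simp
  · have e1 : ((m : ℤ) - 2) / 2 = k - 1 := by omega
    have e2 : ((m : ℤ) - 1) / 2 = k := by omega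
    have e4 : ((m : ℤ) - 3) / 2 = k - 1 := by omega
    have e5 : (m : ℤ) / 2 = k := by omega
    have e3 : (S ℝ (k : ℤ)).eval (2 * Real.cos θ) + (S ℝ ((k : ℤ) - 1)).eval (2 * Real.cos θ) = 0 := by
      have a1 := S_two_mul_real_cos θ ((k : ℤ) - 1)
      have a2 := S_two_mul_real_cos θ (k : ℤ)
      have h : Real.sin ((((k : ℤ) : ℝ) + 1) * θ) = - Real.sin ((((k : ℤ) - 1 : ℤ) + 1 : ℝ) * θ) := by
        rw [← Real.sin_neg, ← Real.sin_add_two_pi (-_)]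
        congr 1
        subst hk; push_cast at hmθ ⊢; linarith
      apply (mul_eq_zero.mp (_ : _ * Real.sin θ = 0)).resolve_right hs
      rw [add_mul, a1, a2, h]; ring
    rw [e1, e2, e4, e5, e3]; simp

open Classical in
lemma geomRep {B : Type*} [Fintype B] {W : Type*} [Group W]
    {M : CoxeterMatrix B} (cs : CoxeterSystem M W) (m : B → B → ℕ)
    (hsymm : ∀ i j, m i j = m j i) (hdiag : ∀ i, m i i = 1) (hoff : ∀ i j, i ≠ j → m i j ≠ 1)
    (hdvd : ∀ i j, m i j ∣ M i j) :
    ∃ ρ : W →* ((B → ℝ) ≃ₗ[ℝ] (B → ℝ)), ∀ i v,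
      ρ (cs.simple i) v = v - fm m i v • (Pi.single i 1 : B → ℝ) := by
  have h2 : ∀ i, fm m i (Pi.single i 1) = 2 := fun i => by
    rw [fm_single, cf, hdiag]; simp
  have hl : M.IsLiftable (fun i => Module.reflection (h2 i)) := by
    intro i j
    by_cases hij : i = j
    · subst hij
      rw [M.diagonal, pow_one]
      ext1 z
      exact Module.involutive_reflection (h2 i) z
    · obtain ⟨c, hc⟩ := hdvd i j
      rw [hc, pow_mul, refl_pow (h2 i) (h2 j) (m i j) (hoff i j hij), one_pow]
      · rw [fm_single, cf]
      · rw [fm_single, cf, hsymm]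
  refine ⟨cs.lift ⟨_, hl⟩, fun i v => ?_⟩
  rw [cs.lift_apply_simple hl, Module.reflection_apply]

lemma simple_ne {B : Type*} [Fintype B] {W : Type*} [Group W]
    {M : CoxeterMatrix B} (cs : CoxeterSystem M W) (i j : B) (hij : i ≠ j) :
    cs.simple i ≠ cs.simple j := by
  classical
  obtain ⟨ρ, hρ⟩ := geomRep cs (fun i j => M i j) (fun i j => M.symmetric i j)
    (fun i => M.diagonal i) (fun i j h => M.off_diagonal i j h) (fun i j => dvd_rfl)
  intro h
  have h1 := hρ i (Pi.single i 1)
  rw [h, hρ j] at h1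
  have h3 := congrFun h1 i
  simp [fm_single, cf, hij] at h3
  norm_num at h3

lemma finrank_ker_inf {V : Type*} [AddCommGroup V] [Module ℝ V] [FiniteDimensional ℝ V]
    (U : Submodule ℝ V) (f : Module.Dual ℝ V) :
    Module.finrank ℝ U ≤ Module.finrank ℝ (U ⊓ LinearMap.ker f : Submodule ℝ V) + 1 := by
  have h1 := Submodule.finrank_sup_add_finrank_inf_eq U (LinearMap.ker f)
  have h2 := LinearMap.finrank_range_add_finrank_ker f
  have h3 : Module.finrank ℝ (LinearMap.range f) ≤ 1 := by
    simpa using Submodule.finrank_le (LinearMap.range f)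
  have h4 := Submodule.finrank_le (U ⊔ LinearMap.ker f)
  omega

lemma finrank_list {V : Type*} [AddCommGroup V] [Module ℝ V] [FiniteDimensional ℝ V]
    {B : Type*} (f : B → Module.Dual ℝ V) (U : Submodule ℝ V) (l : List B) :
    ∃ U' : Submodule ℝ V, U' ≤ U ∧ (∀ i ∈ l, ∀ v ∈ U', f i v = 0) ∧
      Module.finrank ℝ U ≤ Module.finrank ℝ U' + l.length := by
  induction l with
  | nil => exact ⟨U, le_rfl, by simp, by simp⟩
  | cons i l ih =>
    obtain ⟨U', h1, h2, h3⟩ := ih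
    refine ⟨U' ⊓ LinearMap.ker (f i), inf_le_left.trans h1, ?_, ?_⟩
    · intro j hj v hv
      rcases List.mem_cons.mp hj with rfl | hj
      · exact hv.2
      · exact h2 j hj v hv.1
    · have := finrank_ker_inf U' (f i)
      simp only [List.length_cons]; omega

section
variable {B : Type*} [Fintype B] {W : Type*} [Group W]
    {M : CoxeterMatrix B} (cs : CoxeterSystem M W) (m : B → B → ℕ)
    (ρ : W →* ((B → ℝ) ≃ₗ[ℝ] (B → ℝ)))

open Classical in
lemma fix_of_forms (hρ : ∀ i v, ρ (cs.simple i) v = v - fm m i v • (Pi.single i 1 : B → ℝ))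
    (l : List B) (v : B → ℝ) (h : ∀ i ∈ l, fm m i v = 0) : ρ (cs.wordProd l) v = v := by
  induction l with
  | nil => simp
  | cons i l ih =>
    rw [cs.wordProd_cons, map_mul, LinearEquiv.mul_apply, ih (fun j hj => h j (by simp [hj])), hρ,
      h i (by simp)]
    simp

open Classical in
lemma diff_support (hρ : ∀ i v, ρ (cs.simple i) v = v - fm m i v • (Pi.single i 1 : B → ℝ))
    (l : List B) (v : B → ℝ) (j : B) (hj : j ∉ l) : ρ (cs.wordProd l) v j = v j := by
  induction l with
  | nil => simp
  | cons i l ih =>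
    simp only [List.mem_cons, not_or] at hj
    rw [cs.wordProd_cons, map_mul, LinearEquiv.mul_apply, hρ]
    simp [ih hj.2, hj.1]

open Classical in
lemma forms_of_fix (hρ : ∀ i v, ρ (cs.simple i) v = v - fm m i v • (Pi.single i 1 : B → ℝ))
    (l : List B) (hl : l.Nodup) (v : B → ℝ) (h : ρ (cs.wordProd l) v = v) :
    ∀ i ∈ l, fm m i v = 0 := by
  induction l with
  | nil => simp
  | cons i l ih =>
    rw [List.nodup_cons] at hl
    rw [cs.wordProd_cons, map_mul, LinearEquiv.mul_apply, hρ] at h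
    have h0 := congrFun h i
    simp only [Pi.sub_apply, Pi.smul_apply, Pi.single_eq_same, smul_eq_mul, mul_one,
      diff_support cs m ρ hρ l v i hl.1] at h0
    have h1 : fm m i (ρ (cs.wordProd l) v) = 0 := by linarith
    rw [h1, zero_smul, sub_zero] at h
    intro j hj
    rcases List.mem_cons.mp hj with rfl | hj
    · rwa [h] at h1
    · exact ih hl.2 h j hj

/-- the averaged invariant form -/
noncomputable def Q [Fintype W] (u v : B → ℝ) : ℝ := ∑ x : W, ∑ k, ρ x u k * ρ x v k

lemma Q_inv [Fintype W] (y : W) (u v : B → ℝ) : Q ρ (ρ y u) (ρ y v) = Q ρ u v := by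
  unfold Q
  rw [← Equiv.sum_comp (Equiv.mulRight y) (fun x => ∑ k, ρ x u k * ρ x v k)]
  simp

lemma Q_pos [Fintype W] (v : B → ℝ) (h : Q ρ v v = 0) : v = 0 := by
  unfold Q at h
  rw [Finset.sum_eq_zero_iff_of_nonneg
    (fun x _ => Finset.sum_nonneg (fun k _ => mul_self_nonneg _))] at h
  have h1 := h 1 (Finset.mem_univ _)
  rw [Finset.sum_eq_zero_iff_of_nonneg (fun k _ => mul_self_nonneg _)] at h1
  funext k
  simpa using h1 k (Finset.mem_univ _)

/-- `Q` as linear form in the second variable -/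
noncomputable def QL [Fintype W] (u : B → ℝ) : Module.Dual ℝ (B → ℝ) where
  toFun v := Q ρ u v
  map_add' a b := by simp [Q, mul_add, Finset.sum_add_distrib]
  map_smul' c a := by simp [Q, Finset.mul_sum, mul_left_comm]

open Classical in
lemma Q_zero [Fintype W]
    (hρ : ∀ i v, ρ (cs.simple i) v = v - fm m i v • (Pi.single i 1 : B → ℝ))
    (hdiag : ∀ i, m i i = 1) (v : B → ℝ) (i : B) (h : fm m i v = 0) :
    QL ρ v (Pi.single i 1) = 0 := by
  have h1 := Q_inv ρ (cs.simple i) v (Pi.single i 1)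
  have h2 : ρ (cs.simple i) (Pi.single i 1) = -(Pi.single i 1 : B → ℝ) := by
    rw [hρ, fm_single, cf, hdiag]
    simp only [Nat.cast_one, div_one, Real.cos_pi]
    module
  rw [h2, hρ, h, zero_smul, sub_zero] at h1
  change QL ρ v (-_) = QL ρ v _ at h1
  rw [map_neg] at h1
  linarith

end

/-- The permutation action on the reflection representation. -/
noncomputable def Pm {B : Type*} (σ : Equiv.Perm B) : (B → ℝ) ≃ₗ[ℝ] (B → ℝ) :=
  LinearEquiv.funCongrLeft ℝ ℝ σ.symm

lemma Pm_apply {B : Type*} (σ : Equiv.Perm B) (v : B → ℝ) (i : B) : Pm σ v i = v (σ.symm i) := rfl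

lemma Pm_apply' {B : Type*} (σ : Equiv.Perm B) (v : B → ℝ) (i : B) : Pm σ v (σ i) = v i := by
  simp [Pm_apply]

open Classical in
lemma Pm_single {B : Type*} (σ : Equiv.Perm B) (i : B) :
    Pm σ (Pi.single i 1) = Pi.single (σ i) 1 := by
  funext j
  rw [Pm_apply, Pi.single_apply, Pi.single_apply]
  simp [Equiv.symm_apply_eq]

lemma fm_Pm {B : Type*} [Fintype B] (m : B → B → ℕ) (σ : Equiv.Perm B)
    (hm : ∀ i j, m (σ i) (σ j) = m i j) (i : B) (v : B → ℝ) :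
    fm m (σ i) (Pm σ v) = fm m i v := by
  rw [fm_apply, fm_apply, ← Equiv.sum_comp σ]
  simp [Pm_apply, cf, hm]

lemma sameOrbit_apply {B : Type*} (σ : Equiv.Perm B) (i j : B) :
    SameOrbit σ i (σ j) ↔ SameOrbit σ i j := by
  constructor
  · rintro ⟨n, hn⟩
    refine ⟨-1 + n, ?_⟩
    rw [zpow_add, Equiv.Perm.mul_apply, hn]
    simp
  · rintro ⟨n, hn⟩
    refine ⟨1 + n, ?_⟩
    rw [zpow_add, Equiv.Perm.mul_apply, hn]
    simp

lemma sameOrbit_refl {B : Type*} (σ : Equiv.Perm B) (i : B) : SameOrbit σ i i := ⟨0, by simp⟩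

lemma sameOrbit_symm {B : Type*} (σ : Equiv.Perm B) {i j : B} (h : SameOrbit σ i j) :
    SameOrbit σ j i := by
  obtain ⟨n, hn⟩ := h
  exact ⟨-n, by rw [← hn, ← Equiv.Perm.mul_apply, ← zpow_add]; simp⟩

open Classical in
/-- indicator of an orbit -/
noncomputable def ind {B : Type*} (σ : Equiv.Perm B) (i : B) : B → ℝ :=
  fun j => if SameOrbit σ i j then 1 else 0

lemma ind_apply {B : Type*} (σ : Equiv.Perm B) (i j : B) : ind σ i (σ j) = ind σ i j := by
  by_cases h : SameOrbit σ i j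
  · have h' := (sameOrbit_apply σ i j).2 h
    rw [ind, if_pos h', ind, if_pos h]
  · have h' := fun h' => h ((sameOrbit_apply σ i j).1 h')
    rw [ind, if_neg h', ind, if_neg h]

lemma Pm_ind {B : Type*} (σ : Equiv.Perm B) (i : B) : Pm σ (ind σ i) = ind σ i := by
  funext j
  obtain ⟨j, rfl⟩ := σ.surjective j
  rw [Pm_apply']
  exact (ind_apply σ i j).symm

lemma sum_ind {B : Type*} [Fintype B] (σ : Equiv.Perm B) (i : B) (v : B → ℝ) :
    ∑ j, ind σ i j * Pm σ v j = ∑ j, ind σ i j * v j := by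
  rw [← Equiv.sum_comp σ]
  simp [Pm_apply, ind_apply]

lemma fm_orbit {B : Type*} [Fintype B] (m : B → B → ℕ) (σ : Equiv.Perm B)
    (hm : ∀ i j, m (σ i) (σ j) = m i j) (v : B → ℝ) (hv : Pm σ v = v) (i j : B)
    (h : SameOrbit σ i j) : fm m j v = fm m i v := by
  obtain ⟨n, rfl⟩ := h
  have key : ∀ k, fm m (σ k) v = fm m k v := fun k => by
    conv_lhs => rw [← hv]
    exact fm_Pm m σ hm k v
  induction n using Int.induction_on with
  | zero => simp
  | succ n ih => rw [add_comm, zpow_add, Equiv.Perm.mul_apply, zpow_one, key, ih]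
  | pred n ih =>
    rw [← ih, ← key]
    rw [← Equiv.Perm.mul_apply, ← zpow_one_add]
    rw [show (1 : ℤ) + (-(n : ℤ) - 1) = -n by ring]

open Classical in
theorem main {B : Type*} [Fintype B] {W : Type*} [Group W] [Finite W]
    {M : CoxeterMatrix B} (cs : CoxeterSystem M W)
    (σ : Equiv.Perm B) (σW : W ≃* W)
    (hσ : ∀ i, σW (cs.simple i) = cs.simple (σ i))
    (l : List B) (hl : l.Pairwise (fun i j => ¬ SameOrbit σ i j)) (x : W) :
    l.length ≤ cs.length (x⁻¹ * cs.wordProd l * σW x) := by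
  have := Fintype.ofFinite W
  set m : B → B → ℕ := fun i j => orderOf (cs.simple i * cs.simple j) with hmdef
  have hdiag : ∀ i, m i i = 1 := fun i => by simp [hmdef]
  have hm : ∀ i j, m (σ i) (σ j) = m i j := fun i j => by
    simp only [hmdef]
    rw [← hσ, ← hσ, ← map_mul]
    exact MulEquiv.orderOf_eq σW _
  obtain ⟨ρ, hρ⟩ := geomRep cs m
    (fun i j => by
      simp only [hmdef]
      rw [← orderOf_inv]; simp)
    hdiag
    (fun i j hij h => by
      simp only [hmdef, orderOf_eq_one_iff] at h
      exact simple_ne cs i j hij (by rw [mul_eq_one_iff_eq_inv] at h; simpa using h))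
    (fun i j => orderOf_dvd_of_pow_eq_one (cs.simple_mul_simple_pow i j))
  -- intertwining
  have hP : ∀ y v, Pm σ (ρ y v) = ρ (σW y) (Pm σ v) := by
    intro y
    refine cs.simple_induction_left (p := fun y => ∀ v, Pm σ (ρ y v) = ρ (σW y) (Pm σ v)) y
      (fun v => by simp) ?_
    intro w i ih v
    rw [map_mul, map_mul, map_mul, LinearEquiv.mul_apply, LinearEquiv.mul_apply, ← ih, hσ, hρ, hρ,
      fm_Pm m σ hm, map_sub, map_smul, Pm_single]
  set c := cs.wordProd l with hc
  set w := x⁻¹ * c * σW x with hw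
  -- fixed spaces
  let Fix : W → Submodule ℝ (B → ℝ) := fun y =>
    LinearMap.eqLocus ((ρ y).toLinearMap ∘ₗ (Pm σ).toLinearMap) LinearMap.id
  have hFix : ∀ y v, v ∈ Fix y ↔ ρ y (Pm σ v) = v := fun y v => Iff.rfl
  have h1 : Module.finrank ℝ (Fix w) ≤ Module.finrank ℝ (Fix c) := by
    rw [← LinearEquiv.finrank_map_eq (ρ x) (Fix w)]
    apply Submodule.finrank_mono
    rintro _ ⟨v, hv, rfl⟩
    rw [SetLike.mem_coe, hFix] at hv
    rw [hFix]
    change ρ c (Pm σ (ρ x v)) = ρ x v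
    rw [hP]
    conv_rhs => rw [← hv]
    have e : x * w = c * σW x := by rw [hw]; group
    have e1 : ρ x (ρ w (Pm σ v)) = ρ (x * w) (Pm σ v) := by
      rw [map_mul ρ x w, LinearEquiv.mul_apply]
    rw [e1, e, map_mul, LinearEquiv.mul_apply]
  have hF1 : ∀ v, v ∈ Fix 1 ↔ Pm σ v = v := fun v => by rw [hFix]; simp
  -- lower bound
  have h2 : Module.finrank ℝ (Fix 1) ≤ Module.finrank ℝ (Fix w) + cs.length w := by
    obtain ⟨l', hl', hwl'⟩ := cs.exists_isReduced w
    obtain ⟨U, hU1, hU2, hU3⟩ := finrank_list (fm m) (Fix 1) l'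
    have : U ≤ Fix w := by
      intro v hv
      rw [hFix, (hF1 v).1 (hU1 hv), hwl']
      exact fix_of_forms cs m ρ hρ l' v (fun i hi => hU2 i hi v hv)
    have := Submodule.finrank_mono this
    have h4 : cs.length w = l'.length := by rw [hwl']; exact hl'
    omega
  -- upper bound
  have hl2 : ∀ i ∈ l, ∀ j ∈ l, SameOrbit σ i j → i = j := by
    intro i hi j hj hij
    by_contra hne
    have hl' : l.Pairwise (fun i j => i ≠ j → ¬ SameOrbit σ i j) := by
      refine hl.imp ?_
      intro a b h _
      exact h
    refine hl'.forall_of_forall_of_flip (R := fun i j => i ≠ j → ¬ SameOrbit σ i j)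
      ?_ ?_ hi hj hne hij
    · intro a _ h; exact absurd rfl h
    · exact hl.imp (fun h _ hs => h (sameOrbit_symm σ hs))
  have hnd : l.Nodup := by
    refine hl.imp ?_
    rintro a b h rfl
    exact h (sameOrbit_refl σ _)
  have hc1 : ∀ v ∈ Fix c, Pm σ v = v ∧ ∀ i ∈ l, fm m i v = 0 := by
    intro v hv
    rw [hFix] at hv
    have hPv : Pm σ v = v := by
      have hout : ∀ j, j ∉ l → v j = Pm σ v j := fun j hj => by
        have := diff_support cs m ρ hρ l (Pm σ v) j hj
        rwa [← hc, hv] at this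
      funext i
      by_cases hi : i ∈ l
      · have h0 : ∑ j, ind σ i j * (Pm σ v j - v j) = 0 := by
          simp only [mul_sub, Finset.sum_sub_distrib, sum_ind, sub_self]
        rw [Finset.sum_eq_single i] at h0
        · simp only [ind, sameOrbit_refl, if_true, one_mul] at h0
          linarith
        · intro j _ hji
          by_cases hj : j ∈ l
          · have : ¬ SameOrbit σ i j := fun h => hji (hl2 i hi j hj h).symm
            simp [ind, this]
          · rw [hout j hj]; simp
        · simp
      · exact (hout i hi).symm
    refine ⟨hPv, ?_⟩
    rw [hPv] at hv
    exact forms_of_fix cs m ρ hρ l hnd v hv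
  let β : {i // i ∈ l} → (B → ℝ) := fun i => ind σ i.1
  have hβ : LinearIndependent ℝ β := by
    rw [Fintype.linearIndependent_iff]
    intro g hg i
    have := congrFun hg i.1
    rw [Finset.sum_apply, Finset.sum_eq_single i] at this
    · simpa [β, ind, sameOrbit_refl] using this
    · intro j _ hji
      have : ¬ SameOrbit σ j.1 i.1 := fun h => hji (Subtype.ext (hl2 _ j.2 _ i.2 h))
      simp [β, ind, this]
    · simp
  have hβr : Module.finrank ℝ (Submodule.span ℝ (Set.range β)) = l.length := by
    rw [finrank_span_eq_card hβ]
    rw [Fintype.card_of_subtype l.toFinset (by simp), List.toFinset_card_of_nodup hnd]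
  have hdisj : Fix c ⊓ Submodule.span ℝ (Set.range β) = ⊥ := by
    rw [eq_bot_iff]
    rintro v ⟨hv, hvs⟩
    obtain ⟨hv1, hv2⟩ := hc1 v hv
    have hle : Submodule.span ℝ (Set.range β) ≤ LinearMap.ker (QL ρ v) := by
      rw [Submodule.span_le]
      rintro _ ⟨i, rfl⟩
      rw [SetLike.mem_coe, LinearMap.mem_ker]
      have : β i = ∑ j, (ind σ i.1 j) • (Pi.single j 1 : B → ℝ) := by
        funext k
        simp [β, Pi.single_apply]
      rw [this, map_sum]
      refine Finset.sum_eq_zero fun j _ => ?_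
      by_cases hj : SameOrbit σ i.1 j
      · rw [map_smul, Q_zero cs m ρ hρ hdiag v j, smul_zero]
        rw [fm_orbit m σ hm v hv1 _ _ hj]
        exact hv2 _ i.2
      · simp [ind, hj]
    exact Q_pos ρ v (hle hvs)
  have h3 : Module.finrank ℝ (Fix c) + l.length ≤ Module.finrank ℝ (Fix 1) := by
    rw [← hβr, ← Submodule.finrank_sup_add_finrank_inf_eq, hdisj, finrank_bot, add_zero]
    apply Submodule.finrank_mono
    refine sup_le (fun v hv => (hF1 v).2 (hc1 v hv).1) ?_
    rw [Submodule.span_le]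
    rintro _ ⟨i, rfl⟩
    exact (hF1 _).2 (Pm_ind σ _)
  omega

end PCox

open Classical in
/-- Let `W` be a finite Coxeter group with diagram automorphism `σ` and let
`c'` be a partial `σ`-Coxeter element, i.e. a `σ`-Coxeter element of the standard parabolic
`W_K` for a `σ`-stable subset `K` of the simple roots (given by a reduced word with letters
in `K` hitting each `σ`-orbit on `K` exactly once).  Then `c'` has minimal length in its
`σ`-conjugacy class: `ℓ(x⁻¹ c' σ(x)) ≥ ℓ(c')` for every `x ∈ W`. -/
theorem stmt11 {B : Type*} [Fintype B] {W : Type*} [Group W] [Finite W]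
    {M : CoxeterMatrix B} (cs : CoxeterSystem M W)
    (σB : Equiv.Perm B) (σW : W ≃* W)
    (hσ : ∀ i, σW (cs.simple i) = cs.simple (σB i))
    (K : Set B) (hKstab : ∀ i ∈ K, σB i ∈ K)
    (l : List B) (hlK : ∀ i ∈ l, i ∈ K) (hlred : cs.IsReduced l)
    (hlorb : ∀ j ∈ K, l.countP (fun i => decide (SameOrbit σB i j)) = 1)
    (c' : W) (hc' : c' = cs.wordProd l) :
    ∀ x : W, cs.length c' ≤ cs.length (x⁻¹ * c' * σW x) := by
  intro x
  rw [hc']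
  refine (cs.length_wordProd_le l).trans (PCox.main cs σB σW hσ l ?_ x)
  rw [List.pairwise_iff_forall_sublist]
  intro a b hab hs
  have hb : b ∈ l := hab.subset (by simp)
  have h1 := hlorb b (hlK b hb)
  have h2 := hab.countP_le (p := fun i => decide (SameOrbit σB i b))
  simp [hs, PCox.sameOrbit_refl] at h2
  omega
end
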